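/- arXiv:q-alg/9511014 — 5 statements merged into one kernel-verified Lean document; each statement's English description precedes it below -/
import Mathlib

section
/- Let l ≥ 1 be an integer and q a nonzero complex number with q² ≠ 1 and θ := q^{2l+1} + q^{-1} ≠ 0, and let h be a scalar. With U, V, W the explicit (l+1)×(l+1) matrices of the spin-(l/2) almost representation, set Û = (2h/θ)U, V̂ = (2h/θ)V, Ŵ = (2h/θ)W. Then these matrices satisfy the defining relations of the braided enveloping algebra A_{h,q}: q²ÛV̂ − V̂Û = −2hÛ, (q³+q)(ÛŴ − ŴÛ) + (1−q²)V̂² = 2hV̂, −q²V̂Ŵ + ŴV̂ = 2hŴ, and the braided Casimir takes the scalar value (q³+q)ÛŴ + V̂² + (q+q^{-1})ŴÛ = c_k · Id, where c_k = b_l b_{l+2} q^{2l−2} (2h/θ)² and b_n = (qⁿ − q^{−n})/(q − q^{−1}). -/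
open Matrix

noncomputable section

/-- The q-number `b_n = (q^n - q^{-n})/(q - q⁻¹)`. -/
def bq (q : ℂ) (n : ℤ) : ℂ := (q ^ n - q ^ (-n)) / (q - q⁻¹)

/-- `y_i = b_i * b_{l+1-i}`. -/
def yq (l : ℕ) (q : ℂ) (i : ℕ) : ℂ := bq q (i : ℤ) * bq q ((l : ℤ) + 1 - (i : ℤ))

/-- The superdiagonal matrix of 1's: `X̂ e_{j+1} = e_j`. -/
def Xh (l : ℕ) : Matrix (Fin (l + 1)) (Fin (l + 1)) ℂ :=
  Matrix.of fun i j => if (j : ℕ) = (i : ℕ) + 1 then 1 else 0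

/-- `Ĥ = diag(l, l-2, …, -l)`. -/
def Hh (l : ℕ) : Matrix (Fin (l + 1)) (Fin (l + 1)) ℂ :=
  Matrix.diagonal fun i => (l : ℂ) - 2 * ((i : ℕ) : ℂ)

/-- `K = diag(q^l, q^{l-2}, …, q^{-l})`. -/
def Kh (l : ℕ) (q : ℂ) : Matrix (Fin (l + 1)) (Fin (l + 1)) ℂ :=
  Matrix.diagonal fun i => q ^ ((l : ℤ) - 2 * ((i : ℕ) : ℤ))

/-- `K⁻¹ = diag(q^{-l}, q^{2-l}, …, q^l)`. -/
def Khinv (l : ℕ) (q : ℂ) : Matrix (Fin (l + 1)) (Fin (l + 1)) ℂ :=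
  Matrix.diagonal fun i => q ^ (2 * ((i : ℕ) : ℤ) - (l : ℤ))

/-- `Ŷ e_j = y_j e_{j+1}`. -/
def Yh (l : ℕ) (q : ℂ) : Matrix (Fin (l + 1)) (Fin (l + 1)) ℂ :=
  Matrix.of fun i j => if (i : ℕ) = (j : ℕ) + 1 then yq l q ((j : ℕ) + 1) else 0

/-- Adjoint action of `X`: `ρ_End(X)M = X̂M − K⁻¹MKX̂`. -/
def rhoX (l : ℕ) (q : ℂ) (M : Matrix (Fin (l + 1)) (Fin (l + 1)) ℂ) :
    Matrix (Fin (l + 1)) (Fin (l + 1)) ℂ :=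
  Xh l * M - Khinv l q * M * Kh l q * Xh l

/-- Adjoint action of `H`: `ρ_End(H)M = ĤM − MĤ`. -/
def rhoH (l : ℕ) (M : Matrix (Fin (l + 1)) (Fin (l + 1)) ℂ) :
    Matrix (Fin (l + 1)) (Fin (l + 1)) ℂ :=
  Hh l * M - M * Hh l

/-- Adjoint action of `Y`: `ρ_End(Y)M = (ŶM − MŶ)K⁻¹`. -/
def rhoY (l : ℕ) (q : ℂ) (M : Matrix (Fin (l + 1)) (Fin (l + 1)) ℂ) :
    Matrix (Fin (l + 1)) (Fin (l + 1)) ℂ :=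
  (Yh l q * M - M * Yh l q) * Khinv l q

/-- The superdiagonal matrix `U` with entries `(q^{2(l-1)}, …, q², 1)`. -/
def Um (l : ℕ) (q : ℂ) : Matrix (Fin (l + 1)) (Fin (l + 1)) ℂ :=
  Matrix.of fun i j =>
    if (j : ℕ) = (i : ℕ) + 1 then q ^ (2 * ((l : ℤ) - 1 - ((i : ℕ) : ℤ))) else 0

/-- `V = −ρ_End(Y)U`. -/
def Vm (l : ℕ) (q : ℂ) : Matrix (Fin (l + 1)) (Fin (l + 1)) ℂ := -(rhoY l q (Um l q))

/-- `W = (q + q⁻¹)⁻¹ ρ_End(Y)V`. -/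
def Wm (l : ℕ) (q : ℂ) : Matrix (Fin (l + 1)) (Fin (l + 1)) ℂ :=
  (q + q⁻¹)⁻¹ • rhoY l q (Vm l q)

/-- The nonzero entry of `Um` in row `i`. -/
def uEntry (l : ℕ) (q : ℂ) (i : ℕ) : ℂ := q ^ (2 * ((l : ℤ) - 1 - (i : ℤ)))

/-- The diagonal entry of `Vm` in row `i`. -/
def vEntry (l : ℕ) (q : ℂ) (i : ℕ) : ℂ :=
  (uEntry l q i * yq l q (i + 1) - q ^ 2 * uEntry l q i * yq l q i) *
    q ^ (2 * (i : ℤ) - (l : ℤ))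

theorem yq_zero (l : ℕ) (q : ℂ) : yq l q 0 = 0 := by
  simp [yq, bq]

theorem yq_last (l : ℕ) (q : ℂ) : yq l q (l + 1) = 0 := by
  simp [yq, bq]

theorem uEntry_succ (l : ℕ) {q : ℂ} (hq : q ≠ 0) (i : ℕ) :
    uEntry l q i = q ^ 2 * uEntry l q (i + 1) := by
  rw [uEntry, uEntry, ← zpow_natCast q 2, ← zpow_add₀ hq]
  congr 1
  push_cast
  ring

theorem uEntry_eq (l : ℕ) {q : ℂ} (hq : q ≠ 0) (i : ℕ) :
    uEntry l q i = (q ^ l) ^ 2 / (q ^ 2 * (q ^ i) ^ 2) := by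
  rw [uEntry, mul_sub, mul_sub, zpow_sub₀ hq, zpow_sub₀ hq, mul_comm 2 (l : ℤ),
    mul_comm 2 (i : ℤ), _root_.zpow_mul, _root_.zpow_mul]
  norm_cast
  field_simp
  ring

theorem yq_eq (l : ℕ) {q : ℂ} (hq : q ≠ 0) (i : ℕ) :
    yq l q i = (q ^ i - (q ^ i)⁻¹) * (q ^ l * q / q ^ i - q ^ i / (q ^ l * q)) / (q - q⁻¹) ^ 2 := by
  simp only [yq, bq, _root_.zpow_neg, zpow_sub₀ hq, zpow_add₀ hq, zpow_natCast, zpow_one]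
  generalize q - q⁻¹ = d
  generalize q ^ l = a
  generalize q ^ i = x
  field_simp

theorem vEntry_eq (l : ℕ) {q : ℂ} (hq : q ≠ 0) (hq2 : q ^ 2 ≠ 1) (i : ℕ) :
    vEntry l q i = q ^ l / (q ^ 2 - 1) *
      (q ^ l * (q + q⁻¹) / (q ^ i) ^ 2 - q ^ l * q - (q ^ l * q)⁻¹) := by
  have hd : q ^ 2 - 1 ≠ 0 := sub_ne_zero.2 hq2
  have hqq : q - q⁻¹ = (q ^ 2 - 1) / q := by field_simp
  rw [vEntry, yq_eq l hq, yq_eq l hq, uEntry_eq l hq, zpow_sub₀ hq, mul_comm 2 (i : ℤ), _root_.zpow_mul,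
    hqq]
  norm_cast
  rw [pow_succ q i]
  have ha : q ^ l ≠ 0 := pow_ne_zero _ hq
  have hx : q ^ i ≠ 0 := pow_ne_zero _ hq
  generalize q ^ l = a at *
  generalize q ^ i = x at *
  field_simp
  ring

theorem vEntry_sub_succ (l : ℕ) {q : ℂ} (hq : q ≠ 0) (hq2 : q ^ 2 ≠ 1) (i : ℕ) :
    vEntry l q i - vEntry l q (i + 1) = (q + q⁻¹) * uEntry l q i := by
  have hd : q ^ 2 - 1 ≠ 0 := sub_ne_zero.2 hq2
  rw [vEntry_eq l hq hq2, vEntry_eq l hq hq2, uEntry_eq l hq, pow_succ q i]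
  field_simp
  ring

theorem vEntry_twisted_sub_succ (l : ℕ) {q : ℂ} (hq : q ≠ 0) (hq2 : q ^ 2 ≠ 1) (i : ℕ) :
    vEntry l q i - q ^ 2 * vEntry l q (i + 1) = q ^ (2 * (l : ℤ) + 1) + q⁻¹ := by
  have hd : q ^ 2 - 1 ≠ 0 := sub_ne_zero.2 hq2
  rw [vEntry_eq l hq hq2, vEntry_eq l hq hq2, pow_succ q i, zpow_add₀ hq, mul_comm 2 (l : ℤ),
    _root_.zpow_mul]
  norm_cast
  field_simp
  ring

theorem diagonal_commutator_relation (l : ℕ) {q : ℂ} (hq : q ≠ 0) (hq2 : q ^ 2 ≠ 1) (i : ℕ) :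
    (q + q⁻¹) * q ^ 2 * q ^ ((l : ℤ) - 2) *
        (uEntry l q i * yq l q (i + 1) - q ^ 2 * uEntry l q i * yq l q i) +
      (1 - q ^ 2) * (vEntry l q i * vEntry l q i) =
      (q ^ (2 * (l : ℤ) + 1) + q⁻¹) * vEntry l q i := by
  have hd : q ^ 2 - 1 ≠ 0 := sub_ne_zero.2 hq2
  have key : uEntry l q i * yq l q (i + 1) - q ^ 2 * uEntry l q i * yq l q i =
      vEntry l q i * (q ^ l / (q ^ i) ^ 2) := by
    rw [vEntry, zpow_sub₀ hq, mul_comm 2 (i : ℤ), _root_.zpow_mul]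
    norm_cast
    field_simp
  rw [key, vEntry_eq l hq hq2, zpow_sub₀ hq, zpow_add₀ hq, mul_comm 2 (l : ℤ), _root_.zpow_mul]
  norm_cast
  have ha : q ^ l ≠ 0 := pow_ne_zero _ hq
  have hx : q ^ i ≠ 0 := pow_ne_zero _ hq
  generalize q ^ l = a at *
  generalize q ^ i = x at *
  field_simp
  ring

theorem diagonal_casimir_relation (l : ℕ) {q : ℂ} (hq : q ≠ 0) (hq2 : q ^ 2 ≠ 1) (i : ℕ) :
    (q + q⁻¹) * q ^ 2 * q ^ ((l : ℤ) - 2) * (uEntry l q i * yq l q (i + 1)) +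
      vEntry l q i * vEntry l q i +
      (q + q⁻¹) * q ^ ((l : ℤ) - 2) * (q ^ 2 * uEntry l q i * yq l q i) =
      bq q l * bq q ((l : ℤ) + 2) * q ^ (2 * (l : ℤ) - 2) := by
  have hd : q ^ 2 - 1 ≠ 0 := sub_ne_zero.2 hq2
  have hqq : q - q⁻¹ = (q ^ 2 - 1) / q := by field_simp
  rw [vEntry_eq l hq hq2, yq_eq l hq, yq_eq l hq, uEntry_eq l hq, bq, bq]
  simp only [_root_.zpow_neg, zpow_sub₀ hq, zpow_add₀ hq, zpow_natCast, hqq, mul_comm 2 (l : ℤ), _root_.zpow_mul]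
  norm_cast
  rw [pow_succ q i]
  have ha : q ^ l ≠ 0 := pow_ne_zero _ hq
  have hx : q ^ i ≠ 0 := pow_ne_zero _ hq
  generalize q ^ l = a at *
  generalize q ^ i = x at *
  field_simp
  ring

theorem Um_mul_Yh (l : ℕ) (q : ℂ) :
    Um l q * Yh l q = diagonal fun i : Fin (l + 1) => uEntry l q i * yq l q ((i : ℕ) + 1) := by
  ext i j
  rw [mul_apply]
  by_cases hi : (i : ℕ) + 1 < l + 1
  · rw [Finset.sum_eq_single ⟨i + 1, hi⟩ (fun b _ hb => by
      have : (b : ℕ) ≠ i + 1 := fun H => hb (Fin.ext H)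
      simp [Um, this]) (by simp)]
    by_cases hij : i = j
    · subst hij
      simp [Um, Yh, uEntry]
    · have : (i : ℕ) ≠ j := fun H => hij (Fin.ext H)
      simp [Um, Yh, hij, this]
  · have hl : (i : ℕ) = l := by omega
    rw [Finset.sum_eq_zero fun b _ => by
      have : (b : ℕ) ≠ i + 1 := by omega
      simp [Um, this]]
    by_cases hij : i = j
    · subst hij
      simp [hl, yq_last]
    · simp [hij]

theorem Yh_mul_Um (l : ℕ) {q : ℂ} (hq : q ≠ 0) :
    Yh l q * Um l q = diagonal fun i : Fin (l + 1) => q ^ 2 * uEntry l q i * yq l q (i : ℕ) := by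
  ext i j
  rw [mul_apply]
  rcases Nat.eq_zero_or_pos (i : ℕ) with hi | hi
  · rw [Finset.sum_eq_zero fun b _ => by simp [Yh, hi]]
    by_cases hij : i = j
    · subst hij
      simp [hi, yq_zero]
    · simp [hij]
  · obtain ⟨m, hm⟩ := Nat.exists_eq_add_of_lt hi
    rw [zero_add] at hm
    rw [Finset.sum_eq_single ⟨m, by omega⟩ (fun b _ hb => by
      have : m ≠ (b : ℕ) := fun H => hb (Fin.ext H.symm)
      simp [Yh, hm, this]) (by simp)]
    by_cases hij : i = j
    · subst hij
      rw [diagonal_apply_eq, hm, ← uEntry_succ l hq]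
      simp [Um, Yh, uEntry, hm]
      ring
    · have : (j : ℕ) ≠ m + 1 := fun H => hij (Fin.ext (hm.trans H.symm))
      simp [Um, Yh, hij, this]

theorem Vm_eq_diagonal (l : ℕ) {q : ℂ} (hq : q ≠ 0) :
    Vm l q = diagonal fun i : Fin (l + 1) => vEntry l q (i : ℕ) := by
  rw [Vm, rhoY, Um_mul_Yh, Yh_mul_Um l hq, Khinv, diagonal_sub, diagonal_mul_diagonal,
    diagonal_neg]
  congr 1
  funext i
  simp only [vEntry]
  ring

/-- The scalar `(q + q⁻¹)⁻¹ (q + q⁻¹)` is `1` unless `q ^ 2 = -1`, where `Wm` vanishes. -/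
theorem Wm_eq_smul_Yh (l : ℕ) {q : ℂ} (hq : q ≠ 0) (hq2 : q ^ 2 ≠ 1) :
    Wm l q = ((q + q⁻¹)⁻¹ * (q + q⁻¹) * q ^ ((l : ℤ) - 2)) • Yh l q := by
  rw [Wm, mul_assoc, mul_smul]
  congr 1
  rw [rhoY, Vm_eq_diagonal l hq, Khinv]
  ext i j
  rw [mul_diagonal, Matrix.sub_apply, mul_diagonal, diagonal_mul, Matrix.smul_apply]
  by_cases hij : (i : ℕ) = j + 1
  · have hu : uEntry l q j * q ^ (2 * (j : ℤ) - (l : ℤ)) = q ^ ((l : ℤ) - 2) := by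
      rw [uEntry, ← zpow_add₀ hq]
      congr 1
      ring
    simp only [Yh, of_apply, hij, if_true, smul_eq_mul]
    linear_combination yq l q (j + 1) * q ^ (2 * (j : ℤ) - (l : ℤ)) * vEntry_sub_succ l hq hq2 j +
      (q + q⁻¹) * yq l q (j + 1) * hu
  · simp [Yh, hij]

theorem Um_mul_Vm (l : ℕ) {q : ℂ} (hq : q ≠ 0) (hq2 : q ^ 2 ≠ 1) :
    q ^ 2 • (Um l q * Vm l q) - Vm l q * Um l q =
      -(q ^ (2 * (l : ℤ) + 1) + q⁻¹) • Um l q := by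
  rw [Vm_eq_diagonal l hq]
  ext i j
  simp only [Matrix.sub_apply, Matrix.smul_apply, mul_diagonal, diagonal_mul, smul_eq_mul]
  by_cases hij : (j : ℕ) = i + 1
  · rw [hij]
    linear_combination -Um l q i j * vEntry_twisted_sub_succ l hq hq2 i
  · simp [Um, hij]

theorem Vm_mul_Yh (l : ℕ) {q : ℂ} (hq : q ≠ 0) (hq2 : q ^ 2 ≠ 1) :
    (-q ^ 2) • (Vm l q * Yh l q) + Yh l q * Vm l q =
      (q ^ (2 * (l : ℤ) + 1) + q⁻¹) • Yh l q := by
  rw [Vm_eq_diagonal l hq]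
  ext i j
  simp only [Matrix.add_apply, Matrix.smul_apply, mul_diagonal, diagonal_mul, smul_eq_mul]
  by_cases hij : (i : ℕ) = j + 1
  · rw [hij]
    linear_combination Yh l q i j * vEntry_twisted_sub_succ l hq hq2 j
  · simp [Yh, hij]

theorem Um_Wm_commutator (l : ℕ) {q : ℂ} (hq : q ≠ 0) (hq2 : q ^ 2 ≠ 1) :
    (q ^ 3 + q) • (Um l q * Wm l q - Wm l q * Um l q) + (1 - q ^ 2) • (Vm l q * Vm l q) =
      (q ^ (2 * (l : ℤ) + 1) + q⁻¹) • Vm l q := by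
  have hc : (q ^ 3 + q) = (q + q⁻¹) * q ^ 2 := by field_simp
  have ht := mul_inv_mul_cancel (q + q⁻¹)
  rw [Wm_eq_smul_Yh l hq hq2, Vm_eq_diagonal l hq, mul_smul_comm, smul_mul_assoc, Um_mul_Yh,
    Yh_mul_Um l hq, hc]
  ext i j
  by_cases hij : i = j
  · subst hij
    simp only [Matrix.add_apply, Matrix.sub_apply, Matrix.smul_apply, diagonal_mul_diagonal, diagonal_apply_eq,
      smul_eq_mul]
    linear_combination diagonal_commutator_relation l hq hq2 i + q ^ 2 * q ^ ((l : ℤ) - 2) *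
      (uEntry l q i * yq l q (i + 1) - q ^ 2 * uEntry l q i * yq l q i) * ht
  · simp [hij]

theorem braided_casimir (l : ℕ) {q : ℂ} (hq : q ≠ 0) (hq2 : q ^ 2 ≠ 1) :
    (q ^ 3 + q) • (Um l q * Wm l q) + Vm l q * Vm l q + (q + q⁻¹) • (Wm l q * Um l q) =
      (bq q l * bq q ((l : ℤ) + 2) * q ^ (2 * (l : ℤ) - 2)) • 1 := by
  have hc : (q ^ 3 + q) = (q + q⁻¹) * q ^ 2 := by field_simp
  have ht := mul_inv_mul_cancel (q + q⁻¹)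
  rw [Wm_eq_smul_Yh l hq hq2, Vm_eq_diagonal l hq, mul_smul_comm, smul_mul_assoc, Um_mul_Yh,
    Yh_mul_Um l hq, hc]
  ext i j
  by_cases hij : i = j
  · subst hij
    simp only [Matrix.add_apply, Matrix.smul_apply, diagonal_mul_diagonal, diagonal_apply_eq, smul_eq_mul,
      one_apply_eq]
    linear_combination diagonal_casimir_relation l hq hq2 i + q ^ ((l : ℤ) - 2) * q ^ 2 *
      (uEntry l q i * yq l q (i + 1) + uEntry l q i * yq l q i) * ht
  · simp [hij]

theorem Vm_mul_Wm (l : ℕ) {q : ℂ} (hq : q ≠ 0) (hq2 : q ^ 2 ≠ 1) :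
    (-q ^ 2) • (Vm l q * Wm l q) + Wm l q * Vm l q =
      (q ^ (2 * (l : ℤ) + 1) + q⁻¹) • Wm l q := by
  rw [Wm_eq_smul_Yh l hq hq2, mul_smul_comm, smul_mul_assoc, smul_comm _ _ (Yh l q),
    ← Vm_mul_Yh l hq hq2, smul_add, smul_comm _ _ (Vm l q * Yh l q)]

/-- rescaling the spin-(l/2) almost representation by `2h/θ` yields a
representation of the braided enveloping algebra `A_{h,q}`, and the braided Casimir
takes the scalar value `c_k = b_l b_{l+2} q^{2l-2} (2h/θ)²`. -/
theorem rescaled_representation_and_casimir (l : ℕ) (hl : 1 ≤ l) (q : ℂ) (hq : q ≠ 0)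
    (hq2 : q ^ 2 ≠ 1) (h : ℂ) (θ : ℂ) (hθdef : θ = q ^ (2 * (l : ℤ) + 1) + q⁻¹)
    (hθ : θ ≠ 0) :
    ∀ Uh Vh Wh : Matrix (Fin (l + 1)) (Fin (l + 1)) ℂ,
      Uh = (2 * h / θ) • Um l q → Vh = (2 * h / θ) • Vm l q → Wh = (2 * h / θ) • Wm l q →
      (q ^ 2 • (Uh * Vh) - Vh * Uh = (-(2 * h)) • Uh ∧
       (q ^ 3 + q) • (Uh * Wh - Wh * Uh) + (1 - q ^ 2) • (Vh * Vh) = (2 * h) • Vh ∧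
       (-q ^ 2) • (Vh * Wh) + Wh * Vh = (2 * h) • Wh) ∧
      (q ^ 3 + q) • (Uh * Wh) + Vh * Vh + (q + q⁻¹) • (Wh * Uh)
        = (bq q (l : ℤ) * bq q ((l : ℤ) + 2) * q ^ (2 * (l : ℤ) - 2) * (2 * h / θ) ^ 2) • 1 := by
  rintro _ _ _ rfl rfl rfl
  have hs : 2 * h = 2 * h / θ * θ := by field_simp
  have h₁ := Um_mul_Vm l hq hq2
  have h₂ := Um_Wm_commutator l hq hq2
  have h₃ := Vm_mul_Wm l hq hq2
  have h₄ := braided_casimir l hq hq2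
  rw [← hθdef] at h₁ h₂ h₃
  generalize 2 * h / θ = s at *
  rw [hs]
  refine ⟨⟨?_, ?_, ?_⟩, ?_⟩
  · simp only [smul_mul_smul_comm]
    linear_combination (norm := module) s ^ 2 • h₁
  · simp only [smul_mul_smul_comm]
    linear_combination (norm := module) s ^ 2 • h₂
  · simp only [smul_mul_smul_comm]
    linear_combination (norm := module) s ^ 2 • h₃
  · simp only [smul_mul_smul_comm]
    linear_combination (norm := module) s ^ 2 • h₄
end
end

section
/- Let q, h be real numbers with q ≠ 0, and let V be the 3-dimensional space with basis {u, v, w} carrying the braided q-Lie bracket. Then the left adjoint map ρ(z)x = [z, x] is an almost representation of the braided Lie algebra sl(2)_q: there exists a scalar ν such that for all z ∈ V the braided Jacobi identities hold: q²[u,[v,z]] − [v,[u,z]] = −2νh[u,z], (q³+q)([u,[w,z]] − [w,[u,z]]) + (1−q²)[v,[v,z]] = 2νh[v,z], and −q²[v,[w,z]] + [w,[v,z]] = 2νh[w,z]; moreover if h ≠ 0 this ν is nonzero. -/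
noncomputable section

/-- The braided (q-)Lie bracket on the real 3-dimensional space `V` with basis
`u = e₀, v = e₁, w = e₂`, given by the multiplication table
`[u,u]=0, [u,v]=−q²Mu, [u,w]=(q+q⁻¹)⁻¹Mv, [v,u]=Mu, [v,v]=(1−q²)Mv, [v,w]=−q²Mw,
[w,u]=−(q+q⁻¹)⁻¹Mv, [w,v]=Mw, [w,w]=0`, where `M = 2h(1+q⁴)⁻¹`. -/
def qBracket (q h : ℝ) (a b : Fin 3 → ℝ) : Fin 3 → ℝ :=
  let M : ℝ := 2 * h * (1 + q ^ 4)⁻¹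
  ![M * (-(q ^ 2) * a 0 * b 1 + a 1 * b 0),
    M * ((q + q⁻¹)⁻¹ * (a 0 * b 2 - a 2 * b 0) + (1 - q ^ 2) * a 1 * b 1),
    M * (-(q ^ 2) * a 1 * b 2 + a 2 * b 1)]

/-- the left adjoint map `ρ(z)x = [z,x]` is an almost representation of
the braided Lie algebra `sl(2)_q`: there is a scalar `ν` (nonzero when `h ≠ 0`) such
that the braided Jacobi identities hold. -/
theorem adjoint_almost_representation (q h : ℝ) (hq : q ≠ 0) :
    ∃ ν : ℝ,
      (∀ z : Fin 3 → ℝ,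
        q ^ 2 • qBracket q h ![1,0,0] (qBracket q h ![0,1,0] z)
            - qBracket q h ![0,1,0] (qBracket q h ![1,0,0] z)
          = (-(2 * ν * h)) • qBracket q h ![1,0,0] z ∧
        (q ^ 3 + q) • (qBracket q h ![1,0,0] (qBracket q h ![0,0,1] z)
            - qBracket q h ![0,0,1] (qBracket q h ![1,0,0] z))
            + (1 - q ^ 2) • qBracket q h ![0,1,0] (qBracket q h ![0,1,0] z)
          = (2 * ν * h) • qBracket q h ![0,1,0] z ∧
        (-(q ^ 2)) • qBracket q h ![0,1,0] (qBracket q h ![0,0,1] z)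
            + qBracket q h ![0,0,1] (qBracket q h ![0,1,0] z)
          = (2 * ν * h) • qBracket q h ![0,0,1] z) ∧
      (h ≠ 0 → ν ≠ 0) := by
  have hc : q * (q ^ 2 + 1) * (q + q⁻¹)⁻¹ = q ^ 2 := by
    have : q ^ 2 + 1 ≠ 0 := by positivity
    field_simp
  have hd : 1 + q ^ 4 ≠ 0 := by positivity
  refine ⟨(1 - q ^ 2 + q ^ 4) * (1 + q ^ 4)⁻¹, fun z => ?_, fun _ => ?_⟩
  · simp only [qBracket]
    generalize (q + q⁻¹)⁻¹ = c at hc ⊢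
    generalize (1 + q ^ 4)⁻¹ = d
    refine ⟨?_, ?_, ?_⟩
    · ext i
      fin_cases i <;> simp <;> ring
    · ext i
      fin_cases i <;> simp
      · linear_combination (2 * h * d) ^ 2 * q ^ 2 * z 0 * hc
      · linear_combination (2 * h * d) ^ 2 * (1 - q ^ 2) * z 1 * hc
      · linear_combination -(2 * h * d) ^ 2 * z 2 * hc
    · ext i
      fin_cases i <;> simp <;> ring
  · have : 0 < 1 - q ^ 2 + q ^ 4 := by nlinarith [sq_nonneg (q ^ 2 - 1), sq_nonneg q]
    exact mul_ne_zero this.ne' (inv_ne_zero hd)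
end
end

section
/- Let l ≥ 1 be an integer and q a nonzero complex number with q² ≠ 1. The superdiagonal matrix U with entries (q^{2(l−1)}, q^{2(l−2)}, …, q², 1) is a highest weight vector of weight 2 for the adjoint action ρ_End: it satisfies ρ_End(X)U = X̂U − K^{−1}UKX̂ = 0 and ρ_End(H)U = ĤU − UĤ = 2U. -/
open Matrix

noncomputable section

/-- the superdiagonal matrix `U` is a highest weight vector of weight 2
for the adjoint action `ρ_End`. -/
theorem U_highest_weight (l : ℕ) (hl : 1 ≤ l) (q : ℂ) (hq : q ≠ 0) (hq2 : q ^ 2 ≠ 1) :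
    rhoX l q (Um l q) = 0 ∧ rhoH l (Um l q) = (2 : ℂ) • Um l q := by
  constructor
  · rw [rhoX, sub_eq_zero]
    ext i j
    rw [Matrix.mul_apply, Matrix.mul_apply]
    refine Finset.sum_congr rfl fun k _ => ?_
    simp only [Khinv, Kh, Matrix.mul_diagonal, Matrix.diagonal_mul, Xh, Um, Matrix.of_apply]
    by_cases hk : (k : ℕ) = (i : ℕ) + 1
    · by_cases hj : (j : ℕ) = (k : ℕ) + 1
      · rw [if_pos hk, if_pos hj, if_pos hk, if_pos hj, one_mul, mul_one, ← zpow_add₀ hq,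
          ← zpow_add₀ hq, hk]
        congr 1
        push_cast
        ring
      · simp [hj]
    · simp [hk]
  · ext i j
    simp only [rhoH, Hh, Matrix.sub_apply, Matrix.mul_diagonal, Matrix.diagonal_mul, Um,
      Matrix.smul_apply, Matrix.of_apply, smul_eq_mul]
    by_cases hj : (j : ℕ) = (i : ℕ) + 1
    · rw [if_pos hj, hj]
      push_cast
      ring
    · simp [hj]
end
end

section
/- Let q be a nonzero real number. The 9-dimensional space V⊗V decomposes as the internal direct sum V⊗V = V₀ ⊕ V₁ ⊕ V₂, where V₀ = span{(q³+q)u⊗w + v⊗v + (q+q^{−1})w⊗u}, V₁ = span{q²u⊗v − v⊗u, (q³+q)(u⊗w − w⊗u) + (1−q²)v⊗v, −q²v⊗w + w⊗v}, and V₂ = span{u⊗u, u⊗v + q²v⊗u, u⊗w − q·v⊗v + q⁴w⊗u, v⊗w + q²w⊗v, w⊗w}; moreover each of V₀, V₁, V₂ is invariant under the operators X₂ = X̂⊗1 + K^{−1}⊗X̂, Y₂ = 1⊗Ŷ + Ŷ⊗K, and H₂ = Ĥ⊗1 + 1⊗Ĥ. -/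
open Matrix TensorProduct

noncomputable section

/-- The 3-dimensional module `V` with basis `{u, v, w}`. -/
abbrev V3 : Type := Fin 3 → ℝ

def uB : V3 := ![1, 0, 0]
def vB : V3 := ![0, 1, 0]
def wB : V3 := ![0, 0, 1]

/-- `X̂u = 0, X̂v = −(q+q⁻¹)u, X̂w = v`. -/
def Xop (q : ℝ) : V3 →ₗ[ℝ] V3 :=
  Matrix.toLin' !![0, -(q + q⁻¹), 0; 0, 0, 1; 0, 0, 0]

/-- `Ŷu = −v, Ŷv = (q+q⁻¹)w, Ŷw = 0`. -/
def Yop (q : ℝ) : V3 →ₗ[ℝ] V3 :=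
  Matrix.toLin' !![0, 0, 0; -1, 0, 0; 0, q + q⁻¹, 0]

/-- `Ĥu = 2u, Ĥv = 0, Ĥw = −2w`. -/
def Hop : V3 →ₗ[ℝ] V3 := Matrix.toLin' (Matrix.diagonal ![2, 0, -2])

/-- `Ku = q²u, Kv = v, Kw = q⁻²w`. -/
def Kop (q : ℝ) : V3 →ₗ[ℝ] V3 := Matrix.toLin' (Matrix.diagonal ![q ^ 2, 1, (q ^ 2)⁻¹])

/-- `K⁻¹u = q⁻²u, K⁻¹v = v, K⁻¹w = q²w`. -/
def Kinvop (q : ℝ) : V3 →ₗ[ℝ] V3 := Matrix.toLin' (Matrix.diagonal ![(q ^ 2)⁻¹, 1, q ^ 2])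

/-- `X₂ = X̂⊗1 + K⁻¹⊗X̂` acting on `V⊗V`. -/
def X2 (q : ℝ) : V3 ⊗[ℝ] V3 →ₗ[ℝ] V3 ⊗[ℝ] V3 :=
  TensorProduct.map (Xop q) LinearMap.id + TensorProduct.map (Kinvop q) (Xop q)

/-- `Y₂ = 1⊗Ŷ + Ŷ⊗K` acting on `V⊗V`. -/
def Y2 (q : ℝ) : V3 ⊗[ℝ] V3 →ₗ[ℝ] V3 ⊗[ℝ] V3 :=
  TensorProduct.map LinearMap.id (Yop q) + TensorProduct.map (Yop q) (Kop q)

/-- `H₂ = Ĥ⊗1 + 1⊗Ĥ` acting on `V⊗V`. -/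
def H2 : V3 ⊗[ℝ] V3 →ₗ[ℝ] V3 ⊗[ℝ] V3 :=
  TensorProduct.map Hop LinearMap.id + TensorProduct.map LinearMap.id Hop

/-- The spin-0 generator `(q³+q)u⊗w + v⊗v + (q+q⁻¹)w⊗u`. -/
def g0 (q : ℝ) : V3 ⊗[ℝ] V3 :=
  (q ^ 3 + q) • (uB ⊗ₜ[ℝ] wB) + vB ⊗ₜ[ℝ] vB + (q + q⁻¹) • (wB ⊗ₜ[ℝ] uB)

/-- The spin-1 generator `q²u⊗v − v⊗u`. -/
def g1 (q : ℝ) : V3 ⊗[ℝ] V3 := q ^ 2 • (uB ⊗ₜ[ℝ] vB) - vB ⊗ₜ[ℝ] uB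

/-- The spin-1 generator `(q³+q)(u⊗w − w⊗u) + (1−q²)v⊗v`. -/
def g2 (q : ℝ) : V3 ⊗[ℝ] V3 :=
  (q ^ 3 + q) • (uB ⊗ₜ[ℝ] wB - wB ⊗ₜ[ℝ] uB) + (1 - q ^ 2) • (vB ⊗ₜ[ℝ] vB)

/-- The spin-1 generator `−q²v⊗w + w⊗v`. -/
def g3 (q : ℝ) : V3 ⊗[ℝ] V3 := (-(q ^ 2)) • (vB ⊗ₜ[ℝ] wB) + wB ⊗ₜ[ℝ] vB

/-- The trivial component `V₀`. -/
def V0s (q : ℝ) : Submodule ℝ (V3 ⊗[ℝ] V3) := Submodule.span ℝ {g0 q}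

/-- The spin-1 component `V₁`. -/
def V1s (q : ℝ) : Submodule ℝ (V3 ⊗[ℝ] V3) := Submodule.span ℝ {g1 q, g2 q, g3 q}

/-- The spin-2 component `V₂`. -/
def V2s (q : ℝ) : Submodule ℝ (V3 ⊗[ℝ] V3) :=
  Submodule.span ℝ
    {uB ⊗ₜ[ℝ] uB, uB ⊗ₜ[ℝ] vB + q ^ 2 • (vB ⊗ₜ[ℝ] uB),
     uB ⊗ₜ[ℝ] wB - q • (vB ⊗ₜ[ℝ] vB) + q ^ 4 • (wB ⊗ₜ[ℝ] uB),
     vB ⊗ₜ[ℝ] wB + q ^ 2 • (wB ⊗ₜ[ℝ] vB), wB ⊗ₜ[ℝ] wB}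

set_option linter.unusedSimpArgs false

lemma Xop_uB (q : ℝ) : Xop q uB = 0 := by
  ext i; fin_cases i <;> simp [Xop, uB]

lemma Xop_vB (q : ℝ) : Xop q vB = (-(q + q⁻¹)) • uB := by
  ext i; fin_cases i <;> simp [Xop, uB, vB]

lemma Xop_wB (q : ℝ) : Xop q wB = vB := by
  ext i; fin_cases i <;> simp [Xop, vB, wB]

lemma Yop_uB (q : ℝ) : Yop q uB = (-1 : ℝ) • vB := by
  ext i; fin_cases i <;> simp [Yop, uB, vB]

lemma Yop_vB (q : ℝ) : Yop q vB = (q + q⁻¹) • wB := by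
  ext i; fin_cases i <;> simp [Yop, vB, wB]

lemma Yop_wB (q : ℝ) : Yop q wB = 0 := by
  ext i; fin_cases i <;> simp [Yop, wB]

lemma Hop_uB : Hop uB = (2 : ℝ) • uB := by
  ext i; fin_cases i <;> simp [Hop, uB, Matrix.mulVec_diagonal]

lemma Hop_vB : Hop vB = 0 := by
  ext i; fin_cases i <;> simp [Hop, vB, Matrix.mulVec_diagonal]

lemma Hop_wB : Hop wB = (-2 : ℝ) • wB := by
  ext i; fin_cases i <;> simp [Hop, wB, Matrix.mulVec_diagonal]

lemma Kop_uB (q : ℝ) : Kop q uB = q ^ 2 • uB := by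
  ext i; fin_cases i <;> simp [Kop, uB, Matrix.mulVec_diagonal]

lemma Kop_vB (q : ℝ) : Kop q vB = vB := by
  ext i; fin_cases i <;> simp [Kop, vB, Matrix.mulVec_diagonal]

lemma Kop_wB (q : ℝ) : Kop q wB = (q ^ 2)⁻¹ • wB := by
  ext i; fin_cases i <;> simp [Kop, wB, Matrix.mulVec_diagonal]

lemma Kinvop_uB (q : ℝ) : Kinvop q uB = (q ^ 2)⁻¹ • uB := by
  ext i; fin_cases i <;> simp [Kinvop, uB, Matrix.mulVec_diagonal]

lemma Kinvop_vB (q : ℝ) : Kinvop q vB = vB := by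
  ext i; fin_cases i <;> simp [Kinvop, vB, Matrix.mulVec_diagonal]

lemma Kinvop_wB (q : ℝ) : Kinvop q wB = q ^ 2 • wB := by
  ext i; fin_cases i <;> simp [Kinvop, wB, Matrix.mulVec_diagonal]

lemma X2_tmul (q : ℝ) (a b : V3) :
    X2 q (a ⊗ₜ b) = Xop q a ⊗ₜ b + Kinvop q a ⊗ₜ Xop q b := by
  simp [X2]

lemma Y2_tmul (q : ℝ) (a b : V3) :
    Y2 q (a ⊗ₜ b) = a ⊗ₜ Yop q b + Yop q a ⊗ₜ Kop q b := by
  simp [Y2]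

lemma H2_tmul (a b : V3) : H2 (a ⊗ₜ b) = Hop a ⊗ₜ b + a ⊗ₜ Hop b := by
  simp [H2]

/-- The weight-0 generator of the spin-2 component. -/
def h0 (q : ℝ) : V3 ⊗[ℝ] V3 :=
  uB ⊗ₜ[ℝ] wB - q • (vB ⊗ₜ[ℝ] vB) + q ^ 4 • (wB ⊗ₜ[ℝ] uB)

lemma X2_g0 {q : ℝ} (hq : q ≠ 0) : X2 q (g0 q) = 0 := by
  simp only [g0, map_add, map_sub, map_smul, X2_tmul,
    Xop_uB, Xop_vB, Xop_wB, Kinvop_uB, Kinvop_vB, Kinvop_wB,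
    ← smul_tmul', tmul_smul, zero_tmul, tmul_zero]
  match_scalars <;> first | ring1 | (field_simp <;> ring1)

lemma Y2_g0 {q : ℝ} (hq : q ≠ 0) : Y2 q (g0 q) = 0 := by
  simp only [g0, map_add, map_sub, map_smul, Y2_tmul,
    Yop_uB, Yop_vB, Yop_wB, Kop_uB, Kop_vB, Kop_wB,
    ← smul_tmul', tmul_smul, zero_tmul, tmul_zero]
  match_scalars <;> first | ring1 | (field_simp <;> ring1)

lemma H2_g0 (q : ℝ) : H2 (g0 q) = (0 : ℝ) • g0 q := by
  simp only [g0, map_add, map_sub, map_smul, H2_tmul,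
    Hop_uB, Hop_vB, Hop_wB,
    ← smul_tmul', tmul_smul, zero_tmul, tmul_zero]
  module

lemma X2_g1 {q : ℝ} (hq : q ≠ 0) : X2 q (g1 q) = 0 := by
  simp only [g1, map_add, map_sub, map_smul, X2_tmul,
    Xop_uB, Xop_vB, Xop_wB, Kinvop_uB, Kinvop_vB, Kinvop_wB,
    ← smul_tmul', tmul_smul, zero_tmul, tmul_zero]
  match_scalars <;> first | ring1 | (field_simp <;> ring1)

lemma Y2_g1 {q : ℝ} (hq : q ≠ 0) : Y2 q (g1 q) = g2 q := by
  simp only [g1, g2, map_add, map_sub, map_smul, Y2_tmul,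
    Yop_uB, Yop_vB, Yop_wB, Kop_uB, Kop_vB, Kop_wB,
    ← smul_tmul', tmul_smul, zero_tmul, tmul_zero]
  match_scalars <;> first | ring1 | (field_simp <;> ring1)

lemma H2_g1 (q : ℝ) : H2 (g1 q) = (2 : ℝ) • g1 q := by
  simp only [g1, map_add, map_sub, map_smul, H2_tmul,
    Hop_uB, Hop_vB, Hop_wB,
    ← smul_tmul', tmul_smul, zero_tmul, tmul_zero]
  module

lemma X2_g2 {q : ℝ} (hq : q ≠ 0) : X2 q (g2 q) = (q + q⁻¹) • g1 q := by
  simp only [g1, g2, map_add, map_sub, map_smul, X2_tmul,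
    Xop_uB, Xop_vB, Xop_wB, Kinvop_uB, Kinvop_vB, Kinvop_wB,
    ← smul_tmul', tmul_smul, zero_tmul, tmul_zero]
  match_scalars <;> first | ring1 | (field_simp <;> ring1)

lemma Y2_g2 {q : ℝ} (hq : q ≠ 0) : Y2 q (g2 q) = (q + q⁻¹) • g3 q := by
  simp only [g2, g3, map_add, map_sub, map_smul, Y2_tmul,
    Yop_uB, Yop_vB, Yop_wB, Kop_uB, Kop_vB, Kop_wB,
    ← smul_tmul', tmul_smul, zero_tmul, tmul_zero]
  match_scalars <;> first | ring1 | (field_simp <;> ring1)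

lemma H2_g2 (q : ℝ) : H2 (g2 q) = (0 : ℝ) • g2 q := by
  simp only [g2, map_add, map_sub, map_smul, H2_tmul,
    Hop_uB, Hop_vB, Hop_wB,
    ← smul_tmul', tmul_smul, zero_tmul, tmul_zero]
  module

lemma X2_g3 {q : ℝ} (hq : q ≠ 0) : X2 q (g3 q) = g2 q := by
  simp only [g2, g3, map_add, map_sub, map_smul, X2_tmul,
    Xop_uB, Xop_vB, Xop_wB, Kinvop_uB, Kinvop_vB, Kinvop_wB,
    ← smul_tmul', tmul_smul, zero_tmul, tmul_zero]
  match_scalars <;> first | ring1 | (field_simp <;> ring1)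

lemma Y2_g3 {q : ℝ} (hq : q ≠ 0) : Y2 q (g3 q) = 0 := by
  simp only [g3, map_add, map_sub, map_smul, Y2_tmul,
    Yop_uB, Yop_vB, Yop_wB, Kop_uB, Kop_vB, Kop_wB,
    ← smul_tmul', tmul_smul, zero_tmul, tmul_zero]
  match_scalars <;> first | ring1 | (field_simp <;> ring1)

lemma H2_g3 (q : ℝ) : H2 (g3 q) = (-2 : ℝ) • g3 q := by
  simp only [g3, map_add, map_sub, map_smul, H2_tmul,
    Hop_uB, Hop_vB, Hop_wB,
    ← smul_tmul', tmul_smul, zero_tmul, tmul_zero]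
  module

lemma X2_uB_tmul_uB (q : ℝ) : X2 q (uB ⊗ₜ[ℝ] uB) = 0 := by
  simp only [map_add, map_sub, map_smul, X2_tmul,
    Xop_uB, Xop_vB, Xop_wB, Kinvop_uB, Kinvop_vB, Kinvop_wB,
    ← smul_tmul', tmul_smul, zero_tmul, tmul_zero]
  module

lemma Y2_uB_tmul_uB (q : ℝ) :
    Y2 q (uB ⊗ₜ[ℝ] uB) = (-1 : ℝ) • (uB ⊗ₜ[ℝ] vB + q ^ 2 • (vB ⊗ₜ[ℝ] uB)) := by
  simp only [map_add, map_sub, map_smul, Y2_tmul,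
    Yop_uB, Yop_vB, Yop_wB, Kop_uB, Kop_vB, Kop_wB,
    ← smul_tmul', tmul_smul, zero_tmul, tmul_zero]
  module

lemma H2_uB_tmul_uB : H2 (uB ⊗ₜ[ℝ] uB) = (4 : ℝ) • (uB ⊗ₜ[ℝ] uB) := by
  simp only [map_add, map_sub, map_smul, H2_tmul,
    Hop_uB, Hop_vB, Hop_wB,
    ← smul_tmul', tmul_smul, zero_tmul, tmul_zero]
  module

lemma X2_uB_vB (q : ℝ) :
    X2 q (uB ⊗ₜ[ℝ] vB + q ^ 2 • (vB ⊗ₜ[ℝ] uB)) =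
      (-((q + q⁻¹) * (q ^ 2 + (q ^ 2)⁻¹))) • (uB ⊗ₜ[ℝ] uB) := by
  simp only [map_add, map_sub, map_smul, X2_tmul,
    Xop_uB, Xop_vB, Xop_wB, Kinvop_uB, Kinvop_vB, Kinvop_wB,
    ← smul_tmul', tmul_smul, zero_tmul, tmul_zero]
  module

lemma Y2_uB_vB {q : ℝ} (hq : q ≠ 0) :
    Y2 q (uB ⊗ₜ[ℝ] vB + q ^ 2 • (vB ⊗ₜ[ℝ] uB)) = (q + q⁻¹) • h0 q := by
  simp only [h0, map_add, map_sub, map_smul, Y2_tmul,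
    Yop_uB, Yop_vB, Yop_wB, Kop_uB, Kop_vB, Kop_wB,
    ← smul_tmul', tmul_smul, zero_tmul, tmul_zero]
  match_scalars <;> first | ring1 | (field_simp <;> ring1)

lemma H2_uB_vB (q : ℝ) :
    H2 (uB ⊗ₜ[ℝ] vB + q ^ 2 • (vB ⊗ₜ[ℝ] uB)) = (2 : ℝ) • (uB ⊗ₜ[ℝ] vB + q ^ 2 • (vB ⊗ₜ[ℝ] uB)) := by
  simp only [map_add, map_sub, map_smul, H2_tmul,
    Hop_uB, Hop_vB, Hop_wB,
    ← smul_tmul', tmul_smul, zero_tmul, tmul_zero]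
  module

lemma X2_h0 {q : ℝ} (hq : q ≠ 0) :
    X2 q (h0 q) = (q ^ 2 + 1 + (q ^ 2)⁻¹) • (uB ⊗ₜ[ℝ] vB + q ^ 2 • (vB ⊗ₜ[ℝ] uB)) := by
  simp only [h0, map_add, map_sub, map_smul, X2_tmul,
    Xop_uB, Xop_vB, Xop_wB, Kinvop_uB, Kinvop_vB, Kinvop_wB,
    ← smul_tmul', tmul_smul, zero_tmul, tmul_zero]
  match_scalars <;> first | ring1 | (field_simp <;> ring1)

lemma Y2_h0 {q : ℝ} (hq : q ≠ 0) :
    Y2 q (h0 q) = (-(q ^ 2 + 1 + (q ^ 2)⁻¹)) • (vB ⊗ₜ[ℝ] wB + q ^ 2 • (wB ⊗ₜ[ℝ] vB)) := by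
  simp only [h0, map_add, map_sub, map_smul, Y2_tmul,
    Yop_uB, Yop_vB, Yop_wB, Kop_uB, Kop_vB, Kop_wB,
    ← smul_tmul', tmul_smul, zero_tmul, tmul_zero]
  match_scalars <;> first | ring1 | (field_simp <;> ring1)

lemma H2_h0 (q : ℝ) : H2 (h0 q) = (0 : ℝ) • h0 q := by
  simp only [h0, map_add, map_sub, map_smul, H2_tmul,
    Hop_uB, Hop_vB, Hop_wB,
    ← smul_tmul', tmul_smul, zero_tmul, tmul_zero]
  module

lemma X2_vB_wB {q : ℝ} (hq : q ≠ 0) :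
    X2 q (vB ⊗ₜ[ℝ] wB + q ^ 2 • (wB ⊗ₜ[ℝ] vB)) = (-(q + q⁻¹)) • h0 q := by
  simp only [h0, map_add, map_sub, map_smul, X2_tmul,
    Xop_uB, Xop_vB, Xop_wB, Kinvop_uB, Kinvop_vB, Kinvop_wB,
    ← smul_tmul', tmul_smul, zero_tmul, tmul_zero]
  match_scalars <;> first | ring1 | (field_simp <;> ring1)

lemma Y2_vB_wB (q : ℝ) :
    Y2 q (vB ⊗ₜ[ℝ] wB + q ^ 2 • (wB ⊗ₜ[ℝ] vB)) =
      ((q + q⁻¹) * (q ^ 2 + (q ^ 2)⁻¹)) • (wB ⊗ₜ[ℝ] wB) := by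
  simp only [map_add, map_sub, map_smul, Y2_tmul,
    Yop_uB, Yop_vB, Yop_wB, Kop_uB, Kop_vB, Kop_wB,
    ← smul_tmul', tmul_smul, zero_tmul, tmul_zero]
  module

lemma H2_vB_wB (q : ℝ) :
    H2 (vB ⊗ₜ[ℝ] wB + q ^ 2 • (wB ⊗ₜ[ℝ] vB)) =
      (-2 : ℝ) • (vB ⊗ₜ[ℝ] wB + q ^ 2 • (wB ⊗ₜ[ℝ] vB)) := by
  simp only [map_add, map_sub, map_smul, H2_tmul,
    Hop_uB, Hop_vB, Hop_wB,
    ← smul_tmul', tmul_smul, zero_tmul, tmul_zero]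
  module

lemma X2_wB_tmul_wB (q : ℝ) :
    X2 q (wB ⊗ₜ[ℝ] wB) = vB ⊗ₜ[ℝ] wB + q ^ 2 • (wB ⊗ₜ[ℝ] vB) := by
  simp only [map_add, map_sub, map_smul, X2_tmul,
    Xop_uB, Xop_vB, Xop_wB, Kinvop_uB, Kinvop_vB, Kinvop_wB,
    ← smul_tmul', tmul_smul, zero_tmul, tmul_zero]

lemma Y2_wB_tmul_wB (q : ℝ) : Y2 q (wB ⊗ₜ[ℝ] wB) = 0 := by
  simp only [map_add, map_sub, map_smul, Y2_tmul,
    Yop_uB, Yop_vB, Yop_wB, Kop_uB, Kop_vB, Kop_wB,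
    ← smul_tmul', tmul_smul, zero_tmul, tmul_zero]
  module

lemma H2_wB_tmul_wB : H2 (wB ⊗ₜ[ℝ] wB) = (-4 : ℝ) • (wB ⊗ₜ[ℝ] wB) := by
  simp only [map_add, map_sub, map_smul, H2_tmul,
    Hop_uB, Hop_vB, Hop_wB,
    ← smul_tmul', tmul_smul, zero_tmul, tmul_zero]
  module

lemma map_mem_span_of_forall_mem {R M : Type*} [Semiring R] [AddCommMonoid M] [Module R M]
    {s : Set M} {f : M →ₗ[R] M} (h : ∀ x ∈ s, f x ∈ Submodule.span R s) :
    ∀ x ∈ Submodule.span R s, f x ∈ Submodule.span R s :=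
  fun _ hx => (Submodule.span_le (p := (Submodule.span R s).comap f)).2 h hx

lemma V0s_invariant (q : ℝ) {f : V3 ⊗[ℝ] V3 →ₗ[ℝ] V3 ⊗[ℝ] V3}
    (h : f (g0 q) ∈ V0s q) : ∀ x ∈ V0s q, f x ∈ V0s q :=
  map_mem_span_of_forall_mem (by rintro x rfl; exact h)

lemma V1s_invariant (q : ℝ) {f : V3 ⊗[ℝ] V3 →ₗ[ℝ] V3 ⊗[ℝ] V3}
    (h1 : f (g1 q) ∈ V1s q) (h2 : f (g2 q) ∈ V1s q) (h3 : f (g3 q) ∈ V1s q) :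
    ∀ x ∈ V1s q, f x ∈ V1s q :=
  map_mem_span_of_forall_mem (by rintro x (rfl | rfl | rfl) <;> assumption)

lemma V2s_invariant (q : ℝ) {f : V3 ⊗[ℝ] V3 →ₗ[ℝ] V3 ⊗[ℝ] V3}
    (h1 : f (uB ⊗ₜ[ℝ] uB) ∈ V2s q)
    (h2 : f (uB ⊗ₜ[ℝ] vB + q ^ 2 • (vB ⊗ₜ[ℝ] uB)) ∈ V2s q)
    (h3 : f (h0 q) ∈ V2s q)
    (h4 : f (vB ⊗ₜ[ℝ] wB + q ^ 2 • (wB ⊗ₜ[ℝ] vB)) ∈ V2s q)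
    (h5 : f (wB ⊗ₜ[ℝ] wB) ∈ V2s q) :
    ∀ x ∈ V2s q, f x ∈ V2s q :=
  map_mem_span_of_forall_mem (by rintro x (rfl | rfl | rfl | rfl | rfl) <;> assumption)

lemma g0_mem (q : ℝ) : g0 q ∈ V0s q := Submodule.mem_span_of_mem (by simp)

lemma g1_mem (q : ℝ) : g1 q ∈ V1s q := Submodule.mem_span_of_mem (by simp)

lemma g2_mem (q : ℝ) : g2 q ∈ V1s q := Submodule.mem_span_of_mem (by simp)

lemma g3_mem (q : ℝ) : g3 q ∈ V1s q := Submodule.mem_span_of_mem (by simp)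

lemma uB_tmul_uB_mem (q : ℝ) : uB ⊗ₜ[ℝ] uB ∈ V2s q := Submodule.mem_span_of_mem (by simp)

lemma uB_vB_mem (q : ℝ) : uB ⊗ₜ[ℝ] vB + q ^ 2 • (vB ⊗ₜ[ℝ] uB) ∈ V2s q :=
  Submodule.mem_span_of_mem (by simp)

lemma h0_mem (q : ℝ) : h0 q ∈ V2s q := Submodule.mem_span_of_mem (by simp [h0])

lemma vB_wB_mem (q : ℝ) : vB ⊗ₜ[ℝ] wB + q ^ 2 • (wB ⊗ₜ[ℝ] vB) ∈ V2s q :=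
  Submodule.mem_span_of_mem (by simp)

lemma wB_tmul_wB_mem (q : ℝ) : wB ⊗ₜ[ℝ] wB ∈ V2s q := Submodule.mem_span_of_mem (by simp)

lemma V0s_invariant_X2 {q : ℝ} (hq : q ≠ 0) :
    ∀ x ∈ V0s q, X2 q x ∈ V0s q :=
  V0s_invariant q
    (by rw [X2_g0 hq]; exact zero_mem _)

lemma V1s_invariant_X2 {q : ℝ} (hq : q ≠ 0) :
    ∀ x ∈ V1s q, X2 q x ∈ V1s q :=
  V1s_invariant q
    (by rw [X2_g1 hq]; exact zero_mem _)
    (by rw [X2_g2 hq]; exact Submodule.smul_mem _ _ (g1_mem q))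
    (by rw [X2_g3 hq]; exact g2_mem q)

lemma V2s_invariant_X2 {q : ℝ} (hq : q ≠ 0) :
    ∀ x ∈ V2s q, X2 q x ∈ V2s q :=
  V2s_invariant q
    (by rw [X2_uB_tmul_uB q]; exact zero_mem _)
    (by rw [X2_uB_vB q]; exact Submodule.smul_mem _ _ (uB_tmul_uB_mem q))
    (by rw [X2_h0 hq]; exact Submodule.smul_mem _ _ (uB_vB_mem q))
    (by rw [X2_vB_wB hq]; exact Submodule.smul_mem _ _ (h0_mem q))
    (by rw [X2_wB_tmul_wB q]; exact vB_wB_mem q)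

lemma V0s_invariant_Y2 {q : ℝ} (hq : q ≠ 0) :
    ∀ x ∈ V0s q, Y2 q x ∈ V0s q :=
  V0s_invariant q
    (by rw [Y2_g0 hq]; exact zero_mem _)

lemma V1s_invariant_Y2 {q : ℝ} (hq : q ≠ 0) :
    ∀ x ∈ V1s q, Y2 q x ∈ V1s q :=
  V1s_invariant q
    (by rw [Y2_g1 hq]; exact g2_mem q)
    (by rw [Y2_g2 hq]; exact Submodule.smul_mem _ _ (g3_mem q))
    (by rw [Y2_g3 hq]; exact zero_mem _)

lemma V2s_invariant_Y2 {q : ℝ} (hq : q ≠ 0) :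
    ∀ x ∈ V2s q, Y2 q x ∈ V2s q :=
  V2s_invariant q
    (by rw [Y2_uB_tmul_uB q]; exact Submodule.smul_mem _ _ (uB_vB_mem q))
    (by rw [Y2_uB_vB hq]; exact Submodule.smul_mem _ _ (h0_mem q))
    (by rw [Y2_h0 hq]; exact Submodule.smul_mem _ _ (vB_wB_mem q))
    (by rw [Y2_vB_wB q]; exact Submodule.smul_mem _ _ (wB_tmul_wB_mem q))
    (by rw [Y2_wB_tmul_wB q]; exact zero_mem _)

lemma V0s_invariant_H2 (q : ℝ) :
    ∀ x ∈ V0s q, H2 x ∈ V0s q :=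
  V0s_invariant q
    (by rw [H2_g0 q]; exact Submodule.smul_mem _ _ (g0_mem q))

lemma V1s_invariant_H2 (q : ℝ) :
    ∀ x ∈ V1s q, H2 x ∈ V1s q :=
  V1s_invariant q
    (by rw [H2_g1 q]; exact Submodule.smul_mem _ _ (g1_mem q))
    (by rw [H2_g2 q]; exact Submodule.smul_mem _ _ (g2_mem q))
    (by rw [H2_g3 q]; exact Submodule.smul_mem _ _ (g3_mem q))

lemma V2s_invariant_H2 (q : ℝ) :
    ∀ x ∈ V2s q, H2 x ∈ V2s q :=
  V2s_invariant q
    (by rw [H2_uB_tmul_uB]; exact Submodule.smul_mem _ _ (uB_tmul_uB_mem q))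
    (by rw [H2_uB_vB q]; exact Submodule.smul_mem _ _ (uB_vB_mem q))
    (by rw [H2_h0 q]; exact Submodule.smul_mem _ _ (h0_mem q))
    (by rw [H2_vB_wB q]; exact Submodule.smul_mem _ _ (vB_wB_mem q))
    (by rw [H2_wB_tmul_wB]; exact Submodule.smul_mem _ _ (wB_tmul_wB_mem q))

lemma eq_top_of_components_le {q : ℝ} (hq : q ≠ 0) {S : Submodule ℝ (V3 ⊗[ℝ] V3)}
    (h0S : V0s q ≤ S) (h1S : V1s q ≤ S) (h2S : V2s q ≤ S) : S = ⊤ := by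
  have hg0 := h0S (g0_mem q)
  have hg1 := h1S (g1_mem q)
  have hg2 := h1S (g2_mem q)
  have hg3 := h1S (g3_mem q)
  have huv' := h2S (uB_vB_mem q)
  have hh0 := h2S (h0_mem q)
  have hvw' := h2S (vB_wB_mem q)
  have huv : uB ⊗ₜ[ℝ] vB ∈ S := by
    convert (S.add_mem (S.smul_mem (q ^ 2 / (q ^ 4 + 1)) hg1)
      (S.smul_mem (1 / (q ^ 4 + 1)) huv')) using 1
    simp only [g1]
    match_scalars <;> first | ring1 | (field_simp <;> ring1)
  have hvu : vB ⊗ₜ[ℝ] uB ∈ S := by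
    convert (S.add_mem (S.smul_mem (-1 / (q ^ 4 + 1)) hg1)
      (S.smul_mem (q ^ 2 / (q ^ 4 + 1)) huv')) using 1
    simp only [g1]
    match_scalars <;> first | ring1 | (field_simp <;> ring1)
  have hvw : vB ⊗ₜ[ℝ] wB ∈ S := by
    convert (S.add_mem (S.smul_mem (-q ^ 2 / (q ^ 4 + 1)) hg3)
      (S.smul_mem (1 / (q ^ 4 + 1)) hvw')) using 1
    simp only [g3]
    match_scalars <;> first | ring1 | (field_simp <;> ring1)
  have hwv : wB ⊗ₜ[ℝ] vB ∈ S := by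
    convert (S.add_mem (S.smul_mem (1 / (q ^ 4 + 1)) hg3)
      (S.smul_mem (q ^ 2 / (q ^ 4 + 1)) hvw')) using 1
    simp only [g3]
    match_scalars <;> first | ring1 | (field_simp <;> ring1)
  have huw : uB ⊗ₜ[ℝ] wB ∈ S := by
    convert (S.add_mem (S.add_mem (S.smul_mem (q ^ 3 / ((q ^ 2 + 1) * (q ^ 4 + q ^ 2 + 1))) hg0)
      (S.smul_mem (q / ((q ^ 2 + 1) * (q ^ 4 + 1))) hg2))
      (S.smul_mem (1 / ((q ^ 4 + 1) * (q ^ 4 + q ^ 2 + 1))) hh0)) using 1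
    simp only [g0, g2, h0]
    match_scalars <;> first | ring1 | (field_simp <;> ring1)
  have hvv : vB ⊗ₜ[ℝ] vB ∈ S := by
    convert (S.add_mem (S.add_mem (S.smul_mem (q ^ 2 / (q ^ 4 + q ^ 2 + 1)) hg0)
      (S.smul_mem ((1 - q ^ 2) / (q ^ 4 + 1)) hg2))
      (S.smul_mem (-(q * (q ^ 2 + 1) ^ 2) / ((q ^ 4 + 1) * (q ^ 4 + q ^ 2 + 1))) hh0)) using 1
    simp only [g0, g2, h0]
    match_scalars <;> first | ring1 | (field_simp <;> ring1)
  have hwu : wB ⊗ₜ[ℝ] uB ∈ S := by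
    convert (S.add_mem (S.add_mem (S.smul_mem (q / ((q ^ 2 + 1) * (q ^ 4 + q ^ 2 + 1))) hg0)
      (S.smul_mem (-q / ((q ^ 2 + 1) * (q ^ 4 + 1))) hg2))
      (S.smul_mem (q ^ 4 / ((q ^ 4 + 1) * (q ^ 4 + q ^ 2 + 1))) hh0)) using 1
    simp only [g0, g2, h0]
    match_scalars <;> first | ring1 | (field_simp <;> ring1)
  have hspan : ∀ x : V3, x = x 0 • uB + x 1 • vB + x 2 • wB := by
    intro x
    ext i; fin_cases i <;> simp [uB, vB, wB]
  rw [eq_top_iff, ← TensorProduct.span_tmul_eq_top, Submodule.span_le]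
  rintro _ ⟨a, b, rfl⟩
  rw [hspan a, hspan b]
  simp only [TensorProduct.add_tmul, TensorProduct.tmul_add, ← TensorProduct.smul_tmul',
    TensorProduct.tmul_smul]
  have huu := h2S (uB_tmul_uB_mem q)
  have hww := h2S (wB_tmul_wB_mem q)
  repeat' first
    | assumption
    | apply S.add_mem
    | apply S.smul_mem

lemma finrank_V0s_le (q : ℝ) : Module.finrank ℝ (V0s q) ≤ 1 := by
  have := finrank_span_finset_le_card (R := ℝ) {g0 q}
  rwa [Finset.coe_singleton, Finset.card_singleton] at this

lemma finrank_V1s_le (q : ℝ) : Module.finrank ℝ (V1s q) ≤ 3 := by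
  classical
  have := finrank_span_finset_le_card (R := ℝ) {g1 q, g2 q, g3 q}
  simp only [Finset.coe_insert, Finset.coe_singleton] at this
  exact this.trans Finset.card_le_three

lemma finrank_V2s_le (q : ℝ) : Module.finrank ℝ (V2s q) ≤ 5 := by
  classical
  have := finrank_span_finset_le_card (R := ℝ)
    {uB ⊗ₜ[ℝ] uB, uB ⊗ₜ[ℝ] vB + q ^ 2 • (vB ⊗ₜ[ℝ] uB), h0 q,
      vB ⊗ₜ[ℝ] wB + q ^ 2 • (wB ⊗ₜ[ℝ] vB), wB ⊗ₜ[ℝ] wB}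
  simp only [Finset.coe_insert, Finset.coe_singleton] at this
  exact this.trans Finset.card_le_five

lemma isInternal_of_iSup_eq_top_of_sum_finrank_le {K M ι : Type*} [Field K] [AddCommGroup M]
    [Module K M] [FiniteDimensional K M] [Fintype ι] [DecidableEq ι] {A : ι → Submodule K M}
    (htop : iSup A = ⊤) (hle : ∑ i, Module.finrank K (A i) ≤ Module.finrank K M) :
    DirectSum.IsInternal A := by
  have hsurj : Function.Surjective (DirectSum.coeLinearMap A) := by
    rw [← LinearMap.range_eq_top, DirectSum.range_coeLinearMap, htop]
  have hfin : Module.finrank K (DirectSum ι fun i => A i) = Module.finrank K M := by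
    refine le_antisymm ?_ (LinearMap.finrank_le_finrank_of_surjective hsurj)
    rwa [Module.finrank_directSum]
  exact ⟨(LinearMap.injective_iff_surjective_of_finrank_eq_finrank hfin).2 hsurj, hsurj⟩

/-- `V⊗V` decomposes as the internal direct sum `V₀ ⊕ V₁ ⊕ V₂`, and each
summand is invariant under `X₂`, `Y₂` and `H₂`. -/
theorem tensor_square_decomposition (q : ℝ) (hq : q ≠ 0) :
    DirectSum.IsInternal (fun i : Fin 3 => ![V0s q, V1s q, V2s q] i) ∧
    (∀ i : Fin 3, ∀ x ∈ ![V0s q, V1s q, V2s q] i, X2 q x ∈ ![V0s q, V1s q, V2s q] i) ∧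
    (∀ i : Fin 3, ∀ x ∈ ![V0s q, V1s q, V2s q] i, Y2 q x ∈ ![V0s q, V1s q, V2s q] i) ∧
    (∀ i : Fin 3, ∀ x ∈ ![V0s q, V1s q, V2s q] i, H2 x ∈ ![V0s q, V1s q, V2s q] i) := by
  refine ⟨?_, ?_, ?_, ?_⟩
  · refine isInternal_of_iSup_eq_top_of_sum_finrank_le ?_ ?_
    · exact eq_top_of_components_le hq
        (le_iSup (fun i : Fin 3 => ![V0s q, V1s q, V2s q] i) 0)
        (le_iSup (fun i : Fin 3 => ![V0s q, V1s q, V2s q] i) 1)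
        (le_iSup (fun i : Fin 3 => ![V0s q, V1s q, V2s q] i) 2)
    · have h0 := finrank_V0s_le q
      have h1 := finrank_V1s_le q
      have h2 := finrank_V2s_le q
      have h : Module.finrank ℝ (V3 ⊗[ℝ] V3) = 1 + 3 + 5 := by simp
      rw [Fin.sum_univ_three, h]
      exact add_le_add (add_le_add h0 h1) h2
  · intro i
    fin_cases i
    exacts [V0s_invariant_X2 hq, V1s_invariant_X2 hq, V2s_invariant_X2 hq]
  · intro i
    fin_cases i
    exacts [V0s_invariant_Y2 hq, V1s_invariant_Y2 hq, V2s_invariant_Y2 hq]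
  · intro i
    fin_cases i
    exacts [V0s_invariant_H2 q, V1s_invariant_H2 q, V2s_invariant_H2 q]
end
end

section
/- Let q be a nonzero real number with q² ≠ 1, and h, c scalars. The data (V, I ⊂ V⊗V, α, β) of the quantum hyperboloid define a generalized Lie structure, i.e., with J = (I⊗V) ∩ (V⊗I) ⊆ V⊗V⊗V the following three conditions hold: (a) (α⊗id − id⊗α)(J) ⊆ I; (b) (α∘(α⊗id − id⊗α) + β⊗id − id⊗β)(J) = 0; (c) β∘(α⊗id − id⊗α)(J) = 0. -/
open Matrix TensorProduct

noncomputable section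

/-- `I = V₀ ⊕ V₁ ⊆ V⊗V`. -/
def Is (q : ℝ) : Submodule ℝ (V3 ⊗[ℝ] V3) := V0s q ⊔ V1s q

/-- `I⊗V` as a submodule of `(V⊗V)⊗V`. -/
def IV (q : ℝ) : Submodule ℝ ((V3 ⊗[ℝ] V3) ⊗[ℝ] V3) :=
  LinearMap.range (TensorProduct.map (Is q).subtype (LinearMap.id : V3 →ₗ[ℝ] V3))

/-- `V⊗I` as a submodule of `(V⊗V)⊗V` (via the associator). -/
def VI (q : ℝ) : Submodule ℝ ((V3 ⊗[ℝ] V3) ⊗[ℝ] V3) :=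
  LinearMap.range ((TensorProduct.assoc ℝ V3 V3 V3).symm.toLinearMap ∘ₗ
    TensorProduct.map (LinearMap.id : V3 →ₗ[ℝ] V3) (Is q).subtype)

/-- `J = (I⊗V) ∩ (V⊗I)`. -/
def Js (q : ℝ) : Submodule ℝ ((V3 ⊗[ℝ] V3) ⊗[ℝ] V3) := IV q ⊓ VI q

/-- `α⊗id − id⊗α : V⊗V⊗V → V⊗V` (for an extension `αb` of `α` to all of `V⊗V`). -/
def Dmap (αb : V3 ⊗[ℝ] V3 →ₗ[ℝ] V3) :
    (V3 ⊗[ℝ] V3) ⊗[ℝ] V3 →ₗ[ℝ] V3 ⊗[ℝ] V3 :=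
  TensorProduct.map αb LinearMap.id -
    (TensorProduct.map LinearMap.id αb) ∘ₗ (TensorProduct.assoc ℝ V3 V3 V3).toLinearMap

/-- `β⊗id : V⊗V⊗V → V` (for an extension `βb` of `β` to all of `V⊗V`). -/
def Bleft (βb : V3 ⊗[ℝ] V3 →ₗ[ℝ] ℝ) : (V3 ⊗[ℝ] V3) ⊗[ℝ] V3 →ₗ[ℝ] V3 :=
  (TensorProduct.lid ℝ V3).toLinearMap ∘ₗ TensorProduct.map βb LinearMap.id

/-- `id⊗β : V⊗V⊗V → V` (for an extension `βb` of `β` to all of `V⊗V`). -/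
def Bright (βb : V3 ⊗[ℝ] V3 →ₗ[ℝ] ℝ) : (V3 ⊗[ℝ] V3) ⊗[ℝ] V3 →ₗ[ℝ] V3 :=
  (TensorProduct.rid ℝ V3).toLinearMap ∘ₗ TensorProduct.map LinearMap.id βb ∘ₗ
    (TensorProduct.assoc ℝ V3 V3 V3).toLinearMap

/-- An element of `I` is a linear combination of the four generators. -/
lemma exists_eq_of_mem_Is {q : ℝ} {y : V3 ⊗[ℝ] V3} (hy : y ∈ Is q) :
    ∃ a b c d : ℝ, y = a • g0 q + b • g1 q + c • g2 q + d • g3 q := by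
  obtain ⟨y₀, h₀, y₁, h₁, rfl⟩ := Submodule.mem_sup.1 hy
  obtain ⟨a, rfl⟩ := Submodule.mem_span_singleton.1 h₀
  obtain ⟨b, c, d, rfl⟩ := Submodule.mem_span_triple.1 h₁
  exact ⟨a, b, c, d, by abel⟩

/-- Elements of `I ⊗ V` in terms of the generators of `I`. -/
lemma exists_eq_of_mem_IV {q : ℝ} {x : (V3 ⊗[ℝ] V3) ⊗[ℝ] V3} (hx : x ∈ IV q) :
    ∃ a₀ a₁ a₂ a₃ : V3,
      x = g0 q ⊗ₜ[ℝ] a₀ + g1 q ⊗ₜ[ℝ] a₁ + g2 q ⊗ₜ[ℝ] a₂ + g3 q ⊗ₜ[ℝ] a₃ := by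
  obtain ⟨y, rfl⟩ := hx
  induction y with
  | zero => exact ⟨0, 0, 0, 0, by simp⟩
  | tmul i v =>
    obtain ⟨a, b, c, d, hi⟩ := exists_eq_of_mem_Is i.2
    exact ⟨a • v, b • v, c • v, d • v, by simp [hi, add_tmul, smul_tmul]⟩
  | add y z hy hz =>
    obtain ⟨a₀, a₁, a₂, a₃, hy⟩ := hy
    obtain ⟨b₀, b₁, b₂, b₃, hz⟩ := hz
    refine ⟨a₀ + b₀, a₁ + b₁, a₂ + b₂, a₃ + b₃, ?_⟩
    rw [map_add, hy, hz]
    simp only [tmul_add]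
    abel

/-- Elements of `V ⊗ I` in terms of the generators of `I`. -/
lemma exists_eq_of_mem_VI {q : ℝ} {x : (V3 ⊗[ℝ] V3) ⊗[ℝ] V3} (hx : x ∈ VI q) :
    ∃ b₀ b₁ b₂ b₃ : V3,
      x = (TensorProduct.assoc ℝ V3 V3 V3).symm
        (b₀ ⊗ₜ[ℝ] g0 q + b₁ ⊗ₜ[ℝ] g1 q + b₂ ⊗ₜ[ℝ] g2 q + b₃ ⊗ₜ[ℝ] g3 q) := by
  obtain ⟨y, rfl⟩ := hx
  simp only [LinearMap.comp_apply, LinearEquiv.coe_coe, EmbeddingLike.apply_eq_iff_eq]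
  induction y with
  | zero => exact ⟨0, 0, 0, 0, by simp⟩
  | tmul v i =>
    obtain ⟨a, b, c, d, hi⟩ := exists_eq_of_mem_Is i.2
    exact ⟨a • v, b • v, c • v, d • v, by simp [hi, tmul_add, smul_tmul]⟩
  | add y z hy hz =>
    obtain ⟨a₀, a₁, a₂, a₃, hy⟩ := hy
    obtain ⟨b₀, b₁, b₂, b₃, hz⟩ := hz
    refine ⟨a₀ + b₀, a₁ + b₁, a₂ + b₂, a₃ + b₃, ?_⟩
    rw [map_add, hy, hz]
    simp only [add_tmul]
    abel

/-- The monomial basis of `V ⊗ V`. -/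
def tensorBasis₂ : Module.Basis (Fin 3 × Fin 3) ℝ (V3 ⊗[ℝ] V3) :=
  (Pi.basisFun ℝ (Fin 3)).tensorProduct (Pi.basisFun ℝ (Fin 3))

/-- The monomial basis of `(V ⊗ V) ⊗ V`. -/
def tensorBasis₃ : Module.Basis ((Fin 3 × Fin 3) × Fin 3) ℝ ((V3 ⊗[ℝ] V3) ⊗[ℝ] V3) :=
  tensorBasis₂.tensorProduct (Pi.basisFun ℝ (Fin 3))

/-- Comparing the monomial coefficients of the two presentations of an element of `J`. -/
lemma coeff_relations {q : ℝ} (hq : q ≠ 0) {a₀ a₁ a₂ a₃ b₀ b₁ b₂ b₃ : V3}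
    (hab : g0 q ⊗ₜ[ℝ] a₀ + g1 q ⊗ₜ[ℝ] a₁ + g2 q ⊗ₜ[ℝ] a₂ + g3 q ⊗ₜ[ℝ] a₃ =
      (TensorProduct.assoc ℝ V3 V3 V3).symm
        (b₀ ⊗ₜ[ℝ] g0 q + b₁ ⊗ₜ[ℝ] g1 q + b₂ ⊗ₜ[ℝ] g2 q + b₃ ⊗ₜ[ℝ] g3 q)) :
    a₀ = b₀ ∧
      (a₁ 0 = b₁ 0 ∧ a₁ 1 = -b₂ 0 ∧ a₁ 2 = -b₃ 0) ∧
      (a₂ 0 = -b₁ 1 ∧ a₂ 1 = b₂ 1 ∧ a₂ 2 = b₃ 1) ∧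
      (a₃ 0 = -b₁ 2 ∧ a₃ 1 = b₂ 2 ∧ a₃ 2 = b₃ 2) := by
  have key (k l m : Fin 3) := congrArg (fun x => tensorBasis₃.repr x ((k, l), m)) hab
  simp only [g0, g1, g2, g3, uB, vB, wB, tensorBasis₃, tensorBasis₂] at key
  simp [tmul_add, add_tmul, tmul_sub, sub_tmul, Fin.forall_fin_succ, ← smul_tmul', hq] at key
  have hs : q ^ 2 + 1 ≠ 0 := by positivity
  have hp : q ^ 3 + q = q * (q ^ 2 + 1) := by ring
  have hr : q + q⁻¹ = (q ^ 2 + 1) * q⁻¹ := by field_simp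
  have hq' : q * q⁻¹ = 1 := mul_inv_cancel₀ hq
  rw [hp, hr] at key
  have h₀ : a₀ = b₀ := by
    ext i
    fin_cases i <;> simp only [Fin.zero_eta, Fin.mk_one, Fin.reduceFinMk] <;> grind
  refine ⟨h₀, ?_⟩
  subst h₀
  refine ⟨⟨?_, ?_, ?_⟩, ⟨?_, ?_, ?_⟩, ⟨?_, ?_, ?_⟩⟩ <;> grind

/-- The map `α ⊗ id - id ⊗ α` vanishes on `J`, and `β ⊗ id` and `id ⊗ β` agree there. -/
lemma Dmap_eq_zero_and_Bleft_eq_Bright {q h : ℝ} (hq : q ≠ 0)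
    {αb : V3 ⊗[ℝ] V3 →ₗ[ℝ] V3} {βb : V3 ⊗[ℝ] V3 →ₗ[ℝ] ℝ}
    (hα0 : αb (g0 q) = 0)
    (hα1 : αb (g1 q) = (-(2 * h)) • uB)
    (hα2 : αb (g2 q) = (2 * h) • vB)
    (hα3 : αb (g3 q) = (2 * h) • wB)
    (hβ1 : βb (g1 q) = 0) (hβ2 : βb (g2 q) = 0) (hβ3 : βb (g3 q) = 0)
    {x : (V3 ⊗[ℝ] V3) ⊗[ℝ] V3} (hx : x ∈ Js q) :
    Dmap αb x = 0 ∧ Bleft βb x = Bright βb x := by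
  obtain ⟨hIV, hVI⟩ := hx
  obtain ⟨a₀, a₁, a₂, a₃, ha⟩ := exists_eq_of_mem_IV hIV
  obtain ⟨b₀, b₁, b₂, b₃, hb⟩ := exists_eq_of_mem_VI hVI
  have hassoc := (LinearEquiv.eq_symm_apply _).1 hb
  obtain ⟨rfl, ⟨h10, h11, h12⟩, ⟨h20, h21, h22⟩, h30, h31, h32⟩ :=
    coeff_relations hq (ha.symm.trans hb)
  constructor
  · rw [Dmap, LinearMap.sub_apply, LinearMap.comp_apply, LinearEquiv.coe_coe, hassoc, ha]
    simp only [map_add, TensorProduct.map_tmul, LinearMap.id_apply, hα0, hα1, hα2, hα3]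
    apply tensorBasis₂.ext_elem
    rintro ⟨i, j⟩
    fin_cases i <;> fin_cases j <;> simp [tensorBasis₂, uB, vB, wB, *] <;> ring
  · rw [Bright, LinearMap.comp_apply, LinearMap.comp_apply, LinearEquiv.coe_coe,
      LinearEquiv.coe_coe, hassoc, Bleft, LinearMap.comp_apply, LinearEquiv.coe_coe, ha]
    simp [hβ1, hβ2, hβ3]

/-- the data `(V, I ⊂ V⊗V, α, β)` of the quantum hyperboloid define a
generalized Lie structure: for any linear extensions `αb, βb` of the structure maps
`α : I → V`, `β : I → k` (i.e. `α(V₀) = 0`, `β(V₁) = 0`, `α(g₁) = −2hu`, `α(g₂) = 2hv`,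
`α(g₃) = 2hw`, `β(g₀) = c`), with `J = (I⊗V) ∩ (V⊗I)` we have
(a) `(α⊗id − id⊗α)(J) ⊆ I`;
(b) `(α∘(α⊗id − id⊗α) + β⊗id − id⊗β)(J) = 0`;
(c) `β∘(α⊗id − id⊗α)(J) = 0`. -/
theorem generalized_Lie_structure (q h c : ℝ) (hq : q ≠ 0) (hq2 : q ^ 2 ≠ 1)
    (αb : V3 ⊗[ℝ] V3 →ₗ[ℝ] V3) (βb : V3 ⊗[ℝ] V3 →ₗ[ℝ] ℝ)
    (hα0 : αb (g0 q) = 0)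
    (hα1 : αb (g1 q) = (-(2 * h)) • uB)
    (hα2 : αb (g2 q) = (2 * h) • vB)
    (hα3 : αb (g3 q) = (2 * h) • wB)
    (hβ0 : βb (g0 q) = c)
    (hβ1 : βb (g1 q) = 0) (hβ2 : βb (g2 q) = 0) (hβ3 : βb (g3 q) = 0) :
    (∀ x ∈ Js q, Dmap αb x ∈ Is q) ∧
    (∀ x ∈ Js q, αb (Dmap αb x) + Bleft βb x - Bright βb x = 0) ∧
    (∀ x ∈ Js q, βb (Dmap αb x) = 0) := by
  have key {x} (hx : x ∈ Js q) :=
    Dmap_eq_zero_and_Bleft_eq_Bright hq hα0 hα1 hα2 hα3 hβ1 hβ2 hβ3 hx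
  refine ⟨fun x hx => ?_, fun x hx => ?_, fun x hx => ?_⟩
  · rw [(key hx).1]
    exact zero_mem _
  · rw [(key hx).1, (key hx).2, map_zero, zero_add, sub_self]
  · rw [(key hx).1, map_zero]
end
end
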